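/- Let Σ be a finite nonempty alphabet and let L ⊆ Σ^ω be a regular ω-language, i.e. L = ⋃_{i=1}^k U_i·V_i^ω for some k ≥ 1 and regular languages U_i, V_i ⊆ Σ*. Then μ(L) > 0 if and only if L contains a rich ω-word, where μ is the Bernoulli measure on Σ^ω. -/

import Mathlib

open Filter Topology MeasureTheory

namespace Sparse

variable {α : Type*}

/-- The finite word `w` is a prefix of the ω-word `ζ`. -/
def PrefixO (w : List α) (ζ : ℕ → α) : Prop :=
  ∀ i : Fin w.length, ζ i = w.get i

/-- Concatenation `w · ζ` of a finite word with an ω-word. -/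
def appendO (w : List α) (ζ : ℕ → α) : ℕ → α :=
  fun n => if h : n < w.length then w.get ⟨n, h⟩ else ζ (n - w.length)

/-- The concatenation `v 0 · v 1 · ⋯ · v (k-1)` of the first `k` words of a sequence of words. -/
def joinUpTo (v : ℕ → List α) (k : ℕ) : List α :=
  (List.ofFn (fun i : Fin k => v i)).flatten

/-- `V^ω`: the set of ω-words of the form `v₁ · v₂ · v₃ ⋯` with all `vᵢ ∈ V`.  An ω-word `ζ` is
such an infinite concatenation iff each finite concatenation `v₁ ⋯ v_k` is a prefix of `ζ` and
the lengths of these finite concatenations tend to infinity. -/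
def omegaPow (V : Set (List α)) : Set (ℕ → α) :=
  {ζ | ∃ v : ℕ → List α, (∀ i, v i ∈ V) ∧
    Tendsto (fun k => (joinUpTo v k).length) atTop atTop ∧
    ∀ k, PrefixO (joinUpTo v k) ζ}

/-- `U · V^ω = {u · v₁ · v₂ ⋯ : u ∈ U, v₁, v₂, … ∈ V}`. -/
def catOmega (U V : Set (List α)) : Set (ℕ → α) :=
  {ζ | ∃ u ∈ U, ∃ ξ ∈ omegaPow V, ζ = appendO u ξ}

/-- An ω-word `ξ` is rich if every finite word `v` occurs as a factor of `ξ`,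
i.e. `ξ = x · v · y` for some finite word `x` and ω-word `y`. -/
def Rich (ξ : ℕ → α) : Prop :=
  ∀ v : List α, ∃ (x : List α) (y : ℕ → α), ξ = appendO (x ++ v) y

/-- `V* `: the set of finite concatenations of words from `V`. -/
def star (V : Set (List α)) : Set (List α) :=
  {w | ∃ l : List (List α), (∀ v ∈ l, v ∈ V) ∧ w = l.flatten}

/-- A language of finite words is regular iff it is accepted by a DFA. -/
def RegularLang (L : Set (List α)) : Prop :=
  ∃ (σ : Type) (_ : Fintype σ) (M : DFA α σ), L = M.accepts

/-- `L` is infix complete if every finite word occurs as an infix of a word of `L`. -/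
def InfixComplete (L : Set (List α)) : Prop :=
  ∀ w : List α, ∃ x y : List α, x ++ w ++ y ∈ L


/-! ### Finite monoids -/

lemma exists_idem_pow {S : Type*} [Monoid S] [Finite S] (x : S) :
    ∃ n : ℕ, 1 ≤ n ∧ x ^ n * x ^ n = x ^ n := by
  obtain ⟨i, j, hne, hij⟩ := Finite.exists_ne_map_eq_of_infinite (fun n : ℕ => x ^ n)
  wlog hlt : i < j generalizing i j
  · exact this j i hne.symm hij.symm (by omega)
  obtain ⟨p, hp, rfl⟩ : ∃ p, 1 ≤ p ∧ j = i + p := ⟨j - i, by omega, by omega⟩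
  change x ^ i = x ^ (i + p) at hij
  have h1 : ∀ m, i ≤ m → x ^ (m + p) = x ^ m := by
    intro m hm
    obtain ⟨t, rfl⟩ := Nat.exists_eq_add_of_le hm
    rw [show i + t + p = (i + p) + t by ring, pow_add, ← hij, ← pow_add]
  have h2 : ∀ k m, i ≤ m → x ^ (m + k * p) = x ^ m := by
    intro k
    induction k with
    | zero => intro m _; simp
    | succ k ih =>
      intro m hm
      rw [show m + (k + 1) * p = (m + k * p) + p by ring, h1 _ (by omega), ih m hm]
  have h3 : i + 1 ≤ (i + 1) * p := Nat.le_mul_of_pos_right _ hp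
  refine ⟨(i + 1) * p, by omega, ?_⟩
  rw [← pow_add]
  exact h2 _ _ (by omega)

lemma exists_min_idem (S : Type*) [Monoid S] [Finite S] :
    ∃ e : S, e * e = e ∧ ∀ x, ∃ n : ℕ, 1 ≤ n ∧ (e * x * e) ^ n = e := by
  obtain ⟨⟨e, he⟩, hmin⟩ : ∃ e : {e : S // e * e = e}, ∀ f : {e : S // e * e = e},
      (Set.range fun x => e.1 * x * e.1).ncard ≤ (Set.range fun x => f.1 * x * f.1).ncard := by
    have : Nonempty {e : S // e * e = e} := ⟨⟨1, by simp⟩⟩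
    exact Finite.exists_min
      (fun e : {e : S // e * e = e} => (Set.range fun x => e.1 * x * e.1).ncard)
  refine ⟨e, he, fun x => ?_⟩
  obtain ⟨n, hn, hf⟩ := exists_idem_pow (e * x * e)
  refine ⟨n, hn, ?_⟩
  obtain ⟨m, rfl⟩ : ∃ m, n = m + 1 := ⟨n - 1, by omega⟩
  have hef : e * (e * x * e) ^ (m + 1) = (e * x * e) ^ (m + 1) := by
    rw [pow_succ']; simp only [← mul_assoc, he]
  have hfe : (e * x * e) ^ (m + 1) * e = (e * x * e) ^ (m + 1) := by
    rw [pow_succ]; simp only [mul_assoc, he]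
  generalize (e * x * e) ^ (m + 1) = f at *
  have hsub : (Set.range fun x => f * x * f) ⊆ (Set.range fun x => e * x * e) := by
    rintro _ ⟨y, rfl⟩
    refine ⟨f * y * f, ?_⟩
    simp only
    rw [← mul_assoc, ← mul_assoc, hef, mul_assoc, hfe]
  have heq := Set.eq_of_subset_of_ncard_le hsub (hmin ⟨f, hf⟩) (Set.toFinite _)
  have : e ∈ (Set.range fun x => e * x * e) := ⟨1, by simp [he]⟩
  rw [← heq] at this
  obtain ⟨y, hy⟩ := this
  simp only at hy
  rw [← hfe, ← hy, ← mul_assoc, ← mul_assoc, hf]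

lemma conj_idem {S : Type*} [Monoid S] (e a : S) (he : e * e = e)
    (h : ∀ x, ∃ n : ℕ, 1 ≤ n ∧ (e * x * e) ^ n = e) :
    ∃ n : ℕ, 1 ≤ n ∧ (e * a) ^ n * (e * a) ^ n = (e * a) ^ n ∧
      ∀ x, ∃ m : ℕ, 1 ≤ m ∧ ((e * a) ^ n * x * (e * a) ^ n) ^ m = (e * a) ^ n := by
  obtain ⟨n, hn, h1⟩ := h a
  have key : ∀ n, (e * a * e) ^ (n + 1) = (e * a) ^ (n + 1) * e := by
    intro n
    induction n with
    | zero => simp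
    | succ n ih =>
      rw [pow_succ, ih, pow_succ (e * a) (n + 1)]
      simp only [mul_assoc]
      rw [← mul_assoc e e, he]
  obtain ⟨k, rfl⟩ : ∃ k, n = k + 1 := ⟨n - 1, by omega⟩
  have hfe : (e * a) ^ (k + 1) * e = e := by rw [← key, h1]
  have hef : e * (e * a) ^ (k + 1) = (e * a) ^ (k + 1) := by
    rw [pow_succ']; simp only [← mul_assoc, he]
  refine ⟨k + 1, hn, ?_⟩
  generalize (e * a) ^ (k + 1) = f at *
  have hff : f * f = f := by
    rw [← hef, ← mul_assoc, mul_assoc e f e, hfe, he]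
  refine ⟨hff, fun x => ?_⟩
  obtain ⟨m, hm, h2⟩ := h (f * x)
  refine ⟨m, hm, ?_⟩
  rw [← mul_assoc, hef] at h2
  have key2 : ∀ m, (f * x * f) ^ (m + 1) = (f * x * e) ^ (m + 1) * f := by
    intro m
    induction m with
    | zero => simp [mul_assoc, hef]
    | succ m ih =>
      rw [pow_succ, ih, pow_succ (f * x * e) (m + 1)]
      have : f * (f * x * f) = f * x * e * f := by
        simp only [mul_assoc, hef]
        rw [← mul_assoc f f, hff]
      rw [mul_assoc, this]
      simp only [mul_assoc]
  obtain ⟨l, rfl⟩ : ∃ l, m = l + 1 := ⟨m - 1, by omega⟩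
  rw [key2, h2, hef]

/-! ### The monoid of relations -/

/-- Binary relations on `X`, with composition as multiplication. -/
def RelM (X : Type*) := X → X → Prop

instance (X : Type*) : Monoid (RelM X) where
  mul r s := fun x y => ∃ z, r x z ∧ s z y
  one := fun x y => x = y
  mul_assoc r s t := by
    funext x y
    apply propext
    constructor
    · rintro ⟨z, ⟨w, h1, h2⟩, h3⟩; exact ⟨w, h1, z, h2, h3⟩
    · rintro ⟨w, h1, z, h2, h3⟩; exact ⟨z, ⟨w, h1, h2⟩, h3⟩
  one_mul r := by
    funext x y
    apply propext
    constructor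
    · rintro ⟨z, rfl, h⟩; exact h
    · intro h; exact ⟨x, rfl, h⟩
  mul_one r := by
    funext x y
    apply propext
    constructor
    · rintro ⟨z, h, rfl⟩; exact h
    · intro h; exact ⟨y, h, rfl⟩

instance (X : Type*) [Finite X] : Finite (RelM X) :=
  inferInstanceAs (Finite (X → X → Prop))

lemma RelM.mul_apply {X : Type*} (r s : RelM X) (x y : X) :
    (r * s) x y ↔ ∃ z, r x z ∧ s z y := Iff.rfl

lemma RelM.one_apply {X : Type*} (x y : X) : (1 : RelM X) x y ↔ x = y := Iff.rfl

/-! ### Runs with restarts of a DFA -/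

section Runs

variable {σ : Type} (M : DFA α σ)

/-- One step: follow the DFA, or, if an accepting state is reached, restart (setting the flag). -/
def stp (a : α) : RelM (σ × Bool) := fun x y =>
  y = (M.step x.1 a, x.2) ∨ (M.step x.1 a ∈ M.accept ∧ y = (M.start, true))

/-- The relation of a word. -/
def P (w : List α) : RelM (σ × Bool) := (w.map (stp M)).prod

lemma P_nil : P M [] = 1 := by simp [P]
lemma P_cons (a : α) (w : List α) : P M (a :: w) = stp M a * P M w := by simp [P]
lemma P_append (u v : List α) : P M (u ++ v) = P M u * P M v := by simp [P]

lemma P_pow (w : List α) (n : ℕ) : ∃ u, P M u = P M w ^ n := by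
  induction n with
  | zero => exact ⟨[], by simp [P_nil]⟩
  | succ n ih =>
    obtain ⟨u, hu⟩ := ih
    exact ⟨u ++ w, by rw [P_append, hu, pow_succ]⟩

lemma P_or (d : Bool) (w : List α) : ∀ (p q : σ) (b c : Bool), P M w (p, b) (q, c) →
    P M w (p, b || d) (q, c || d) := by
  induction w with
  | nil =>
    intro p q b c h
    rw [P_nil, RelM.one_apply] at h ⊢
    simp_all
  | cons a w ih =>
    intro p q b c h
    rw [P_cons, RelM.mul_apply] at h ⊢
    obtain ⟨⟨z, f⟩, h1, h2⟩ := h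
    refine ⟨(z, f || d), ?_, ih _ _ _ _ h2⟩
    rcases h1 with h1 | ⟨h1, h3⟩
    · left; simp_all
    · right; simp_all

lemma P_false (w : List α) : ∀ (p q : σ) (b c : Bool), P M w (p, b) (q, c) →
    ∃ c', P M w (p, false) (q, c') := by
  induction w with
  | nil =>
    intro p q b c h
    rw [P_nil, RelM.one_apply] at h
    refine ⟨false, ?_⟩
    rw [P_nil, RelM.one_apply]
    simp_all
  | cons a w ih =>
    intro p q b c h
    rw [P_cons, RelM.mul_apply] at h
    obtain ⟨⟨z, f⟩, h1, h2⟩ := h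
    rcases h1 with h1 | ⟨h1, h3⟩
    · obtain ⟨c', hc⟩ := ih _ _ _ _ h2
      refine ⟨c', ?_⟩
      rw [P_cons, RelM.mul_apply]
      exact ⟨_, Or.inl rfl, by simp_all⟩
    · refine ⟨c, ?_⟩
      rw [P_cons, RelM.mul_apply]
      exact ⟨(z, f), Or.inr ⟨h1, h3⟩, h2⟩

lemma P_comp {u v : List α} {p q r : σ} {b c : Bool} (h1 : P M u (p, false) (q, b))
    (h2 : P M v (q, false) (r, c)) : P M (u ++ v) (p, false) (r, c || b) := by
  rw [P_append, RelM.mul_apply]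
  exact ⟨(q, b), h1, by simpa using P_or M b v _ _ _ _ h2⟩

lemma P_split {u v : List α} {p r : σ} {c : Bool} (h : P M (u ++ v) (p, false) (r, c)) :
    ∃ q b c', P M u (p, false) (q, b) ∧ P M v (q, false) (r, c') := by
  rw [P_append, RelM.mul_apply] at h
  obtain ⟨⟨q, b⟩, h1, h2⟩ := h
  obtain ⟨c', h3⟩ := P_false M v _ _ _ _ h2
  exact ⟨q, b, c', h1, h3⟩

lemma P_accept (w : List α) : ∀ (p : σ), w ≠ [] → M.evalFrom p w ∈ M.accept →
    P M w (p, false) (M.start, true) := by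
  induction w with
  | nil => intro p h; exact absurd rfl h
  | cons a w ih =>
    intro p _ h
    rw [P_cons, RelM.mul_apply]
    by_cases hw : w = []
    · subst hw
      refine ⟨(M.start, true), Or.inr ⟨by simpa using h, rfl⟩, ?_⟩
      rw [P_nil, RelM.one_apply]
    · refine ⟨(M.step p a, false), Or.inl rfl, ih _ hw ?_⟩
      simpa using h

lemma P_true (w : List α) : ∀ (p q : σ), P M w (p, false) (q, true) →
    ∃ a b c, w = a ++ b ∧ a ≠ [] ∧ M.evalFrom p a ∈ M.accept ∧
      P M b (M.start, false) (q, c) := by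
  induction w with
  | nil =>
    intro p q h
    rw [P_nil, RelM.one_apply] at h
    simp at h
  | cons a w ih =>
    intro p q h
    rw [P_cons, RelM.mul_apply] at h
    obtain ⟨⟨z, f⟩, h1, h2⟩ := h
    rcases h1 with h1 | ⟨h1, h3⟩
    · simp only [Prod.mk.injEq] at h1
      obtain ⟨rfl, rfl⟩ := h1
      obtain ⟨a', b, c, rfl, h4, h5, h6⟩ := ih _ _ h2
      exact ⟨a :: a', b, c, by simp, by simp, by simpa using h5, h6⟩
    · simp only [Prod.mk.injEq] at h3
      obtain ⟨rfl, rfl⟩ := h3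
      obtain ⟨c', h4⟩ := P_false M w _ _ _ _ h2
      exact ⟨[a], w, c', by simp, by simp, by simpa using h1, h4⟩

end Runs

/-! ### Factors of ω-words -/

/-- The factor of `ζ` of length `l` at position `n`. -/
def tk (ζ : ℕ → α) (n l : ℕ) : List α := (List.range' n l).map ζ

lemma tk_length (ζ : ℕ → α) (n l : ℕ) : (tk ζ n l).length = l := by simp [tk]

lemma tk_zero (ζ : ℕ → α) (n : ℕ) : tk ζ n 0 = [] := by simp [tk]

lemma tk_add (ζ : ℕ → α) (n a b : ℕ) : tk ζ n (a + b) = tk ζ n a ++ tk ζ (n + a) b := by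
  simp [tk, ← List.map_append, List.range'_append_1]

lemma tk_shift (ζ : ℕ → α) (m n l : ℕ) : tk (fun i => ζ (m + i)) n l = tk ζ (m + n) l := by
  apply List.ext_getElem
  · simp [tk]
  · intro i h1 h2; simp [tk, add_assoc]

lemma prefixO_iff (w : List α) (ζ : ℕ → α) : PrefixO w ζ ↔ tk ζ 0 w.length = w := by
  unfold PrefixO
  constructor
  · intro h
    apply List.ext_getElem
    · simp [tk]
    · intro i h1 h2
      simpa [tk] using h ⟨i, h2⟩
  · intro h i
    have h2 : (tk ζ 0 w.length)[i.1]'(by simp [tk]) = w[i.1] := by simp only [h]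
    simpa [tk] using h2

lemma tk_append_split {ζ : ℕ → α} {n : ℕ} {u v : List α}
    (h : tk ζ n (u ++ v).length = u ++ v) :
    tk ζ n u.length = u ∧ tk ζ (n + u.length) v.length = v := by
  rw [List.length_append, tk_add] at h
  exact List.append_inj h (by simp [tk])

lemma appendO_shift (w : List α) (ζ : ℕ → α) :
    (fun i => appendO w ζ (w.length + i)) = ζ := by
  funext i; simp [appendO]

lemma appendO_eq_iff (w : List α) (ζ ξ : ℕ → α) :
    ζ = appendO w ξ ↔ tk ζ 0 w.length = w ∧ ξ = fun i => ζ (w.length + i) := by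
  constructor
  · rintro rfl
    refine ⟨?_, (appendO_shift w ξ).symm⟩
    rw [← prefixO_iff]
    intro i
    simp [appendO]
  · rintro ⟨h, rfl⟩
    rw [← prefixO_iff] at h
    funext n
    unfold appendO
    split_ifs with hn
    · exact h ⟨n, hn⟩
    · congr 1; omega

lemma rich_iff (ζ : ℕ → α) : Rich ζ ↔ ∀ v : List α, ∃ n, tk ζ n v.length = v := by
  constructor
  · intro h v
    obtain ⟨x, y, hxy⟩ := h v
    rw [appendO_eq_iff] at hxy
    have := (tk_append_split hxy.1).2
    exact ⟨_, this⟩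
  · intro h v
    obtain ⟨n, hn⟩ := h v
    refine ⟨tk ζ 0 n, fun i => ζ ((tk ζ 0 n ++ v).length + i), ?_⟩
    rw [appendO_eq_iff]
    refine ⟨?_, rfl⟩
    rw [List.length_append, tk_length, tk_add]
    simp [hn]

lemma rich_late [Nonempty α] {ζ : ℕ → α} (h : Rich ζ) (v : List α) (N : ℕ) :
    ∃ n, N ≤ n ∧ tk ζ n v.length = v := by
  rw [rich_iff] at h
  obtain ⟨n, hn⟩ := h (List.replicate N (Classical.arbitrary α) ++ v)
  exact ⟨_, by simp, (tk_append_split hn).2⟩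

lemma joinUpTo_succ (v : ℕ → List α) (k : ℕ) : joinUpTo v (k + 1) = joinUpTo v k ++ v k := by
  unfold joinUpTo
  rw [List.ofFn_succ_last]
  simp

lemma mem_omegaPow_of_step {V : Set (List α)} {ζ : ℕ → α} (D : Set ℕ) (h0 : 0 ∈ D)
    (h : ∀ n ∈ D, ∃ l, 1 ≤ l ∧ n + l ∈ D ∧ tk ζ n l ∈ V) : ζ ∈ omegaPow V := by
  choose! l h1 h2 h3 using h
  let c : ℕ → ℕ := fun i => Nat.rec 0 (fun _ n => n + l n) i
  have hc : ∀ i, c (i + 1) = c i + l (c i) := fun i => rfl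
  have hD : ∀ i, c i ∈ D := by
    intro i
    induction i with
    | zero => exact h0
    | succ i ih => rw [hc]; exact h2 _ ih
  have hj : ∀ k, joinUpTo (fun i => tk ζ (c i) (l (c i))) k = tk ζ 0 (c k) := by
    intro k
    induction k with
    | zero => simp [joinUpTo, c, tk]
    | succ k ih => rw [joinUpTo_succ, ih, hc, tk_add]; simp
  refine ⟨fun i => tk ζ (c i) (l (c i)), fun i => h3 _ (hD i), ?_, ?_⟩
  · simp only [hj, tk_length]
    apply StrictMono.tendsto_atTop
    apply strictMono_nat_of_lt_succ
    intro n
    rw [hc]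
    have := h1 _ (hD n)
    omega
  · intro k
    rw [prefixO_iff, hj, tk_length]

lemma mem_omegaPow_of_run {σ : Type} (M : DFA α σ) {ζ : ℕ → α} (r : σ) (D : Set ℕ)
    (hD : ∀ N, ∃ d ∈ D, N < d)
    (hr : ∀ d ∈ D, ∀ l, 1 ≤ l → d + l ∈ D → P M (tk ζ d l) (r, false) (r, true))
    (h0 : ∃ d ∈ D, ∃ b, P M (tk ζ 0 d) (M.start, false) (r, b)) :
    ζ ∈ omegaPow (M.accepts : Set (List α)) := by
  apply mem_omegaPow_of_step {n | ∃ l, n + l ∈ D ∧ ∃ b, P M (tk ζ n l) (M.start, false) (r, b)}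
  · obtain ⟨d, hd, b, h⟩ := h0
    exact ⟨d, by simpa using hd, b, h⟩
  · rintro n ⟨l, hl, b, h⟩
    obtain ⟨d, hd, hlt⟩ := hD (n + l)
    obtain ⟨l', rfl⟩ := Nat.exists_eq_add_of_lt hlt
    have h' := P_comp M h (hr _ hl (l' + 1) (by omega) (by simpa [add_assoc] using hd))
    rw [← tk_add] at h'
    obtain ⟨a, w, c, h4, h5, h6, h7⟩ := P_true M _ _ _ h'
    have hlen := congrArg List.length h4
    rw [tk_length, List.length_append] at hlen
    rw [hlen, tk_add] at h4
    obtain ⟨h8, h9⟩ := List.append_inj h4 (by simp [tk])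
    refine ⟨a.length, List.length_pos_iff.mpr h5, ⟨w.length, ?_, c, ?_⟩, ?_⟩
    · rw [add_assoc, ← hlen]; simpa [add_assoc] using hd
    · rw [h9]; exact h7
    · rw [h8]; exact h6

lemma P_join {σ : Type} (M : DFA α σ) (v : ℕ → List α)
    (hv : ∀ i, v i ∈ (M.accepts : Set (List α))) (k : ℕ) :
    joinUpTo v k = [] ∨ P M (joinUpTo v k) (M.start, false) (M.start, true) := by
  induction k with
  | zero => left; simp [joinUpTo]
  | succ k ih =>
    rw [joinUpTo_succ]
    by_cases hk : v k = []
    · simpa [hk] using ih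
    · right
      have h1 := P_accept M (v k) M.start hk (hv k)
      rcases ih with ih | ih
      · simpa [ih] using h1
      · exact P_comp M ih h1

lemma exists_min_word {σ : Type} [Finite σ] (M : DFA α σ) :
    ∃ e : List α, ∀ a : List α, ∃ n : ℕ, 1 ≤ n ∧
      P M (e ++ a) ^ n * P M (e ++ a) ^ n = P M (e ++ a) ^ n ∧
      ∀ w, ∃ m : ℕ, 1 ≤ m ∧
        (P M (e ++ a) ^ n * P M w * P M (e ++ a) ^ n) ^ m = P M (e ++ a) ^ n := by
  let S : Submonoid (RelM (σ × Bool)) :=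
    { carrier := Set.range (P M)
      mul_mem' := by
        rintro _ _ ⟨u, rfl⟩ ⟨v, rfl⟩
        exact ⟨u ++ v, P_append M u v⟩
      one_mem' := ⟨[], P_nil M⟩ }
  obtain ⟨⟨_, e, rfl⟩, h1, h2⟩ := exists_min_idem S
  refine ⟨e, fun a => ?_⟩
  obtain ⟨n, hn, h3, h4⟩ := conj_idem _ (⟨P M a, a, rfl⟩ : S) h1 h2
  rw [P_append]
  refine ⟨n, hn, congrArg Subtype.val h3, fun w => ?_⟩
  obtain ⟨m, hm, h⟩ := h4 ⟨P M w, w, rfl⟩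
  exact ⟨m, hm, congrArg Subtype.val h⟩

lemma P_pow_true {σ : Type} (M : DFA α σ) (w : List α) (p : σ)
    (h : P M w (p, false) (p, true)) (n : ℕ) :
    ∃ u, P M u = P M w ^ (n + 1) ∧ P M u (p, false) (p, true) := by
  induction n with
  | zero => exact ⟨w, by simp, h⟩
  | succ n ih =>
    obtain ⟨u, hu, hp⟩ := ih
    exact ⟨u ++ w, by rw [P_append, hu, pow_succ _ (n + 1)], P_comp M hp h⟩

lemma exists_loop_word {σ : Type} [Finite σ] (M : DFA α σ) (ξ : ℕ → α)
    (hξ : ξ ∈ omegaPow (M.accepts : Set (List α)))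
    (hr : ∀ v : List α, ∃ n, tk ξ n v.length = v) :
    ∃ (x f : List α) (p : σ) (b : Bool), P M x (M.start, false) (p, b) ∧
      P M f (p, false) (p, true) ∧ P M f * P M f = P M f ∧
      ∀ w, ∃ m : ℕ, 1 ≤ m ∧ (P M f * P M w * P M f) ^ m = P M f := by
  obtain ⟨e, he⟩ := exists_min_word M
  obtain ⟨n, hn⟩ := hr e
  obtain ⟨v, hv, hlim, hpre⟩ := hξ
  obtain ⟨k, hk⟩ := (hlim.eventually (eventually_ge_atTop (n + e.length + 1))).exists
  have hz := (P_join M v hv k).resolve_left (by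
    intro h; rw [h] at hk; simp at hk)
  have hj := (prefixO_iff _ _).1 (hpre k)
  obtain ⟨t, ht⟩ := Nat.exists_eq_add_of_le hk
  rw [ht, show n + e.length + 1 + t = n + (e.length + (1 + t)) by ring, tk_add, tk_add,
    zero_add, hn] at hj
  rw [← hj] at hz
  generalize tk ξ 0 n = x at hz
  generalize tk ξ (n + e.length) (1 + t) = y at hz
  obtain ⟨p, b, c, h1, h2⟩ := P_split M hz
  have h3 := P_comp M (P_comp M h2 hz) h1
  have h4 : P M (e ++ (y ++ (x ++ (e ++ y)) ++ x)) (p, false) (p, true) := by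
    simpa using h3
  obtain ⟨N, hN, h5, h6⟩ := he (y ++ (x ++ (e ++ y)) ++ x)
  obtain ⟨N, rfl⟩ : ∃ k, N = k + 1 := ⟨N - 1, by omega⟩
  obtain ⟨f, hf, hfp⟩ := P_pow_true M _ p h4 N
  rw [← hf] at h5 h6
  exact ⟨x, f, p, b, h1, hfp, h5, h6⟩

lemma exists_forcing {σ : Type} [Finite σ] (M : DFA α σ) (ξ : ℕ → α)
    (hξ : ξ ∈ omegaPow (M.accepts : Set (List α)))
    (hr : ∀ v : List α, ∃ n, tk ξ n v.length = v) :
    ∃ x f : List α, ∀ ζ : ℕ → α, tk ζ 0 x.length = x →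
      (∀ N, ∃ n, N ≤ n ∧ tk ζ n f.length = f) → ζ ∈ omegaPow (M.accepts : Set (List α)) := by
  obtain ⟨x, f, p, b, hx, hp, hid, hgrp⟩ := exists_loop_word M ξ hξ hr
  refine ⟨x ++ (f ++ f), f ++ f, fun ζ hpre hocc => ?_⟩
  obtain ⟨hx1, hx2⟩ := tk_append_split hpre
  obtain ⟨hx2, hx3⟩ := tk_append_split hx2
  rw [zero_add] at hx2 hx3
  let Cut : ℕ → Prop := fun n => f.length ≤ n ∧ tk ζ (n - f.length) f.length = f ∧
    tk ζ n f.length = f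
  have hnext : ∀ n, ∃ n', Cut n' ∧ n + 2 * f.length + 1 ≤ n' := by
    intro n
    obtain ⟨m, hm, h⟩ := hocc (n + f.length + 1)
    obtain ⟨h1, h2⟩ := tk_append_split h
    exact ⟨m + f.length, ⟨by omega, by simpa using h1, h2⟩, by omega⟩
  choose nx hnx1 hnx2 using hnext
  let c : ℕ → ℕ := fun i => Nat.rec (x.length + f.length) (fun _ n => nx n) i
  have hc0 : c 0 = x.length + f.length := rfl
  have hc : ∀ i, c (i + 1) = nx (c i) := fun i => rfl
  have hcut : ∀ i, Cut (c i) := by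
    intro i
    cases i with
    | zero => exact ⟨by simp [hc0], by simpa [hc0] using hx2, by simpa [hc0] using hx3⟩
    | succ i => rw [hc]; exact hnx1 _
  have hgap1 : ∀ i, c i + 2 * f.length + 1 ≤ c (i + 1) := fun i => by rw [hc]; exact hnx2 _
  have hmono : StrictMono c := strictMono_nat_of_lt_succ fun i => by have := hgap1 i; omega
  have hgap : ∀ i j, i < j → c i + 2 * f.length + 1 ≤ c j := by
    intro i j hij
    exact (hgap1 i).trans (hmono.monotone hij)
  have hseg : ∀ i j l, i < j → c j = c i + l → ∃ h, P M (tk ζ (c i) l) = P M f * P M h * P M f := by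
    intro i j l hij hl
    have h1 := hgap i j hij
    obtain ⟨t, ht⟩ : ∃ t, l = f.length + (t + f.length) := ⟨l - 2 * f.length, by omega⟩
    refine ⟨tk ζ (c i + f.length) t, ?_⟩
    have h2 := (hcut j).2.1
    rw [show c j - f.length = c i + f.length + t by omega] at h2
    rw [ht, tk_add, tk_add, (hcut i).2.2, h2, P_append, P_append, mul_assoc]
  obtain ⟨g, hg⟩ := Finite.exists_infinite_fiber
    (fun j : ℕ => P M (tk ζ (c 0) (c (j + 1) - c 0)))
  have hJ : ∀ N, ∃ j, N < j ∧ P M (tk ζ (c 0) (c (j + 1) - c 0)) = g := by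
    intro N
    obtain ⟨j, hj, hlt⟩ := (Set.infinite_coe_iff.1 hg).exists_gt N
    exact ⟨j, hlt, hj⟩
  obtain ⟨j0, -, hj0⟩ := hJ 0
  -- group structure of `g`
  obtain ⟨h, hh⟩ := hseg 0 (j0 + 1) (c (j0 + 1) - c 0) (by omega)
    (by have := hmono (show 0 < j0 + 1 by omega); omega)
  rw [hj0] at hh
  have hFg : P M f * g = g := by
    rw [hh, ← mul_assoc, ← mul_assoc, hid]
  obtain ⟨m, hm, hgm⟩ := hgrp h
  rw [← hh] at hgm
  obtain ⟨m, rfl⟩ : ∃ k, m = k + 1 := ⟨m - 1, by omega⟩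
  obtain ⟨K, hK⟩ := P_pow M (tk ζ (c 0) (c (j0 + 1) - c 0)) m
  rw [hj0] at hK
  have hgK : g * P M K = P M f := by rw [hK, ← pow_succ', hgm]
  have hKg : P M K * g = P M f := by rw [hK, ← pow_succ, hgm]
  -- the state `r`
  have hp' : P M (tk ζ (c 0) (c (j0 + 1) - c 0) ++ K) (p, false) (p, true) := by
    rw [P_append, hj0, hgK]; exact hp
  obtain ⟨r, b1, b2, hr1, hr2⟩ := P_split M hp'
  have hrr : P M f (r, false) (r, true) := by
    have h1 := P_comp M (P_comp M hr2 hp) hr1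
    rw [P_append, P_append, hj0, mul_assoc, hFg, hKg] at h1
    simpa using h1
  refine mem_omegaPow_of_run M r
    {d | ∃ j, d = c (j + 1) ∧ P M (tk ζ (c 0) (c (j + 1) - c 0)) = g} ?_ ?_ ?_
  · intro N
    obtain ⟨j, hj, hjg⟩ := hJ N
    refine ⟨_, ⟨j, rfl, hjg⟩, ?_⟩
    have := hmono.id_le (j + 1)
    simp only [id] at this
    omega
  · rintro _ ⟨i, rfl, hi⟩ l hl ⟨j, hj, hjg⟩
    have hij : i + 1 < j + 1 := by
      apply hmono.lt_iff_lt.1; omega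
    obtain ⟨w, hw⟩ := hseg (i + 1) (j + 1) l hij hj.symm
    have h1 := hmono (show 0 < i + 1 by omega)
    have h2 : g = g * P M (tk ζ (c (i + 1)) l) := by
      conv_lhs => rw [← hjg]
      rw [show c (j + 1) - c 0 = (c (i + 1) - c 0) + l by omega, tk_add, P_append, hi]
      rw [show c 0 + (c (i + 1) - c 0) = c (i + 1) by omega]
    have h3 : P M (tk ζ (c (i + 1)) l) = P M f := by
      have h4 : P M f * P M (tk ζ (c (i + 1)) l) = P M (tk ζ (c (i + 1)) l) := by
        rw [hw, ← mul_assoc, ← mul_assoc, hid]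
      rw [← h4, ← hKg, mul_assoc, ← h2]
    rw [h3]; exact hrr
  · refine ⟨_, ⟨j0, rfl, hj0⟩, ?_⟩
    have h1 := hmono (show 0 < j0 + 1 by omega)
    have h2 := P_comp M (P_comp M hx hp) hr1
    refine ⟨b1 || (true || b), ?_⟩
    rw [show c (j0 + 1) = x.length + (f.length + (c (j0 + 1) - c 0)) by omega, tk_add, tk_add,
      hx1, zero_add, hx2, ← List.append_assoc]
    exact h2

/-! ### Almost every word is rich -/

section Meas

variable [Fintype α] [Nonempty α] [MeasurableSpace α]

lemma measure_avoid_le (μ : Measure (ℕ → α))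
    (hμ : ∀ w : List α, μ {ζ | PrefixO w ζ} = ((Fintype.card α : ENNReal))⁻¹ ^ w.length)
    (v : List α) (n : ℕ) : ∀ w : List α,
    μ {ζ | tk ζ 0 w.length = w ∧ ∀ n, w.length ≤ n → tk ζ n v.length ≠ v} ≤
      ((Fintype.card α : ENNReal))⁻¹ ^ w.length *
        (((Fintype.card α ^ v.length - 1 : ℕ) : ENNReal) *
          ((Fintype.card α : ENNReal))⁻¹ ^ v.length) ^ n := by
  classical
  induction n with
  | zero =>
    intro w
    rw [pow_zero, mul_one, ← hμ w]
    apply measure_mono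
    intro ζ h
    exact (prefixO_iff _ _).2 h.1
  | succ n ih =>
    intro w
    obtain ⟨v', hv'⟩ : ∃ v' : List.Vector α v.length, v'.1 = v := ⟨⟨v, rfl⟩, rfl⟩
    obtain ⟨s, hsdef⟩ : ∃ s : Finset (List.Vector α v.length), s = Finset.univ.erase v' :=
      ⟨_, rfl⟩
    have hs : s.card = Fintype.card α ^ v.length - 1 := by
      rw [hsdef, Finset.card_erase_of_mem (Finset.mem_univ _), Finset.card_univ, card_vector]
    have hsub : {ζ : ℕ → α | tk ζ 0 w.length = w ∧ ∀ n, w.length ≤ n → tk ζ n v.length ≠ v} ⊆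
        ⋃ u ∈ s, {ζ | tk ζ 0 (w ++ u.1).length = w ++ u.1 ∧
          ∀ n, (w ++ u.1).length ≤ n → tk ζ n v.length ≠ v} := by
      rintro ζ ⟨h1, h2⟩
      simp only [Set.mem_iUnion]
      refine ⟨⟨tk ζ w.length v.length, tk_length _ _ _⟩, ?_, ?_, ?_⟩
      · rw [hsdef]
        refine Finset.mem_erase.2 ⟨fun h => ?_, Finset.mem_univ _⟩
        exact h2 _ le_rfl ((congrArg Subtype.val h).trans hv')
      · rw [List.length_append, tk_add, h1, tk_length, zero_add]
      · intro n hn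
        apply h2
        rw [List.length_append] at hn
        omega
    refine (measure_mono hsub).trans ((measure_biUnion_finset_le _ _).trans ?_)
    refine (Finset.sum_le_sum (fun u _ => ih (w ++ u.1))).trans ?_
    have hlen : ∀ u : List.Vector α v.length, (w ++ u.1).length = w.length + v.length := by
      intro u
      rw [List.length_append, u.2]
    simp only [hlen]
    rw [Finset.sum_const, hs, nsmul_eq_mul, pow_add, pow_succ]
    apply le_of_eq
    ring

lemma measure_avoid (μ : Measure (ℕ → α))
    (hμ : ∀ w : List α, μ {ζ | PrefixO w ζ} = ((Fintype.card α : ENNReal))⁻¹ ^ w.length)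
    (v : List α) : μ {ζ | ∀ n, tk ζ n v.length ≠ v} = 0 := by
  have hc : 0 < Fintype.card α := Fintype.card_pos
  have hq : (((Fintype.card α ^ v.length - 1 : ℕ) : ENNReal) *
          ((Fintype.card α : ENNReal))⁻¹ ^ v.length) < 1 := by
    rw [← ENNReal.inv_pow, ← div_eq_mul_inv]
    apply ENNReal.div_lt_of_lt_mul
    rw [one_mul]
    have : 0 < Fintype.card α ^ v.length := by positivity
    exact_mod_cast Nat.sub_lt this one_pos
  have hlim := ENNReal.tendsto_pow_atTop_nhds_zero_of_lt_one hq
  refine le_antisymm (ge_of_tendsto' hlim fun n => ?_) zero_le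
  have := measure_avoid_le μ hμ v n []
  simpa [tk_zero] using this

lemma measure_not_rich (μ : Measure (ℕ → α))
    (hμ : ∀ w : List α, μ {ζ | PrefixO w ζ} = ((Fintype.card α : ENNReal))⁻¹ ^ w.length) :
    μ {ζ | ¬ Rich ζ} = 0 := by
  have : {ζ : ℕ → α | ¬ Rich ζ} ⊆ ⋃ v : List α, {ζ | ∀ n, tk ζ n v.length ≠ v} := by
    intro ζ h
    rw [Set.mem_ofPred_eq, rich_iff] at h
    push Not at h
    exact Set.mem_iUnion.2 h
  refine measure_mono_null this ?_
  have : Countable α := Finite.to_countable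
  exact measure_iUnion_null fun v => measure_avoid μ hμ v

end Meas

/-- A regular ω-language `L = ⋃ᵢ Uᵢ·Vᵢ^ω` has positive Bernoulli measure iff it
contains a rich ω-word.  Here `μ` is the Bernoulli measure on `Σ^ω`, characterised by giving
each cylinder `{ζ : w ≺ ζ}` the measure `|Σ|^{-|w|}`. -/
theorem measure_pos_iff_rich {α : Type*} [Fintype α] [Nonempty α]
    [MeasurableSpace α] [DiscreteMeasurableSpace α]
    (μ : Measure (ℕ → α))
    (hμ : ∀ w : List α, μ {ζ | PrefixO w ζ} = ((Fintype.card α : ENNReal))⁻¹ ^ w.length)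
    (k : ℕ) (hk : 1 ≤ k) (U V : Fin k → Set (List α))
    (hU : ∀ i, RegularLang (U i)) (hV : ∀ i, RegularLang (V i))
    (L : Set (ℕ → α)) (hL : L = ⋃ i, catOmega (U i) (V i)) :
    0 < μ L ↔ ∃ ξ ∈ L, Rich ξ := by
  have hnr := measure_not_rich μ hμ
  constructor
  · intro hpos
    by_contra hno
    push Not at hno
    exact hpos.ne' (measure_mono_null (fun ζ hζ => hno ζ hζ) hnr)
  · rintro ⟨ζ₀, hζ₀, hrich⟩
    rw [hL] at hζ₀
    obtain ⟨i, u, hu, ξ, hξ, heq⟩ := Set.mem_iUnion.1 hζ₀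
    obtain ⟨σ, hσ, M, hM⟩ := hV i
    rw [hM] at hξ
    obtain ⟨-, hsh⟩ := (appendO_eq_iff _ _ _).1 heq
    obtain ⟨x, f, hxf⟩ := exists_forcing M ξ hξ (by
      intro v
      obtain ⟨n, hn, h⟩ := rich_late hrich v u.length
      refine ⟨n - u.length, ?_⟩
      rw [hsh, tk_shift, Nat.add_sub_cancel' hn, h])
    have hsub : {ζ | PrefixO (u ++ x) ζ} ⊆ L ∪ {ζ | ¬ Rich ζ} := by
      intro ζ hζ
      by_cases hr : Rich ζ
      · left
        obtain ⟨h1, h2⟩ := tk_append_split ((prefixO_iff _ _).1 hζ)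
        rw [hL]
        refine Set.mem_iUnion.2 ⟨i, u, hu, fun j => ζ (u.length + j), ?_, ?_⟩
        · rw [hM]
          apply hxf
          · rw [tk_shift]; simpa using h2
          · intro N
            obtain ⟨n, hn, h⟩ := rich_late hr f (u.length + N)
            refine ⟨n - u.length, by omega, ?_⟩
            rw [tk_shift, Nat.add_sub_cancel' (by omega), h]
        · rw [appendO_eq_iff]; exact ⟨h1, rfl⟩
      · right; exact hr
    have h1 := (measure_mono hsub).trans (measure_union_le (μ := μ) _ _)
    rw [hnr, add_zero, hμ] at h1
    refine lt_of_lt_of_le ?_ h1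
    exact ENNReal.pow_pos (ENNReal.inv_pos.2 (ENNReal.natCast_ne_top _)) _

end Sparse
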